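/- Standing hypotheses as in the context, and let P : H → H^L be the orthogonal projection. (a) If K is a closed subspace of H^L invariant under W(x) for all x ∈ (1/2)L, then P(H(K)) = K. (b) If K₁, K₂ are orthogonal closed subspaces of H^L, each invariant under W(x) for all x ∈ (1/2)L, then H(K₁) and H(K₂) are orthogonal. (c) If (K_i) is a family of such pairwise orthogonal subspaces whose orthogonal direct sum is H^L, and if H(H^L) = H, then H is the closure of the orthogonal direct sum of the subspaces H(K_i). -/

import Mathlib

/-- The smallest closed subspace of `H` containing `K` and invariant under all `W x`. -/
def smallestInvariantSubspace {G : Type*} {H : Type*} [NormedAddCommGroup H]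
    [InnerProductSpace ℂ H] (W : G → H →L[ℂ] H) (K : Set H) : Submodule ℂ H :=
  sInf {S : Submodule ℂ H |
    K ⊆ (S : Set H) ∧ IsClosed (S : Set H) ∧ ∀ (x : G), ∀ ψ ∈ S, W x ψ ∈ S}

section SmallestInvariantSubspace

variable {G : Type*} {H : Type*} [NormedAddCommGroup H] [InnerProductSpace ℂ H]
  {W : G → H →L[ℂ] H}

theorem subset_smallestInvariantSubspace (K : Set H) :
    K ⊆ (smallestInvariantSubspace W K : Set H) := by
  intro ψ hψ
  rw [SetLike.mem_coe, smallestInvariantSubspace, Submodule.mem_sInf]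
  exact fun S hS => hS.1 hψ

theorem smallestInvariantSubspace_le {K : Set H} {S : Submodule ℂ H} (hK : K ⊆ (S : Set H))
    (hS : IsClosed (S : Set H)) (hW : ∀ x, ∀ ψ ∈ S, W x ψ ∈ S) :
    smallestInvariantSubspace W K ≤ S :=
  sInf_le ⟨hK, hS, hW⟩

theorem map_mem_smallestInvariantSubspace {K : Set H} (x : G) {ψ : H}
    (hψ : ψ ∈ smallestInvariantSubspace W K) : W x ψ ∈ smallestInvariantSubspace W K := by
  rw [smallestInvariantSubspace, Submodule.mem_sInf] at hψ ⊢
  exact fun S hS => hS.2.2 x ψ (hψ S hS)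

theorem map_mem_topologicalClosure_iSup {ι : Type*} {T : H →L[ℂ] H} {S : ι → Submodule ℂ H}
    (hT : ∀ i, ∀ ψ ∈ S i, T ψ ∈ S i) {ψ : H} (hψ : ψ ∈ (⨆ i, S i).topologicalClosure) :
    T ψ ∈ (⨆ i, S i).topologicalClosure := by
  have hle : (⨆ i, S i) ≤ (⨆ i, S i).comap (T : H →ₗ[ℂ] H) :=
    iSup_le fun i φ hφ => Submodule.mem_iSup_of_mem i (hT i φ hφ)
  exact map_mem_closure T.continuous hψ fun φ hφ => hle hφ

end SmallestInvariantSubspace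

section ProjectiveRepresentation

variable {G : Type*} [AddCommGroup G] {m : G → G → Circle} {L : AddSubgroup G}
  {H : Type*} [NormedAddCommGroup H] [InnerProductSpace ℂ H] {W : G → H →L[ℂ] H}

theorem mul_swap_eq_one_of_alternating (hm₁ : ∀ x y z, m (x + y) z = m x z * m y z)
    (hm₂ : ∀ x y z, m x (y + z) = m x y * m x z) (hmalt : ∀ x, m x x = 1) (x y : G) :
    m x y * m y x = 1 := by
  have h := hmalt (x + y)
  rw [hm₁, hm₂, hm₂, hmalt, hmalt, one_mul, mul_one] at h
  exact h

/-- The commutation relation, written with `m (x + x) y = m x y ^ 2`. -/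
theorem map_map_swap (hm₁ : ∀ x y z, m (x + y) z = m x z * m y z)
    (hm₂ : ∀ x y z, m x (y + z) = m x y * m x z) (hmalt : ∀ x, m x x = 1)
    (hWmul : ∀ x y : G, (W x).comp (W y) = (m x y : ℂ) • W (x + y)) (x y : G) (ψ : H) :
    W x (W y ψ) = (m (x + x) y : ℂ) • W y (W x ψ) := by
  have hxy : W x (W y ψ) = (m x y : ℂ) • W (x + y) ψ := congrArg (fun T => T ψ) (hWmul x y)
  have hyx : W y (W x ψ) = (m y x : ℂ) • W (y + x) ψ := congrArg (fun T => T ψ) (hWmul y x)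
  rw [hxy, hyx, smul_smul, ← Circle.coe_mul, hm₁, mul_assoc,
    mul_swap_eq_one_of_alternating hm₁ hm₂ hmalt, mul_one, add_comm y x]

theorem map_mem_orthogonal_of_add_self_notMem
    (hm₁ : ∀ x y z, m (x + y) z = m x z * m y z)
    (hm₂ : ∀ x y z, m x (y + z) = m x y * m x z) (hmalt : ∀ x, m x x = 1)
    (hL : (L : Set G) = {x : G | ∀ a ∈ L, m x a = 1})
    (hWmul : ∀ x y : G, (W x).comp (W y) = (m x y : ℂ) • W (x + y))
    (hWunitary : ∀ (x : G) (ψ φ : H), @inner ℂ H _ (W x ψ) (W x φ) = @inner ℂ H _ ψ φ)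
    {HL : Submodule ℂ H} (hHL : ∀ ψ : H, ψ ∈ HL ↔ ∀ a ∈ L, W a ψ = ψ)
    {x : G} (hx : x + x ∉ L) {ψ : H} (hψ : ψ ∈ HL) : W x ψ ∈ HLᗮ := by
  have hx' : x + x ∉ {x : G | ∀ a ∈ L, m x a = 1} := by rwa [← hL]
  simp only [Set.mem_ofPred_eq, not_forall] at hx'
  obtain ⟨a, ha, hne⟩ := hx'
  rw [Submodule.mem_orthogonal]
  intro φ hφ
  have hswap := map_map_swap hm₁ hm₂ hmalt hWmul x a ψ
  rw [(hHL ψ).1 hψ a ha] at hswap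
  have hinner : inner ℂ φ (W x ψ) = (m (x + x) a : ℂ) * inner ℂ φ (W x ψ) := by
    calc inner ℂ φ (W x ψ) = inner ℂ φ ((m (x + x) a : ℂ) • W a (W x ψ)) := by rw [← hswap]
      _ = (m (x + x) a : ℂ) * inner ℂ (W a φ) (W a (W x ψ)) := by
        rw [inner_smul_right, (hHL φ).1 hφ a ha]
      _ = _ := by rw [hWunitary]
  by_contra h0
  exact hne (Circle.ext (by simpa using (mul_eq_right₀ h0).1 hinner.symm))

theorem map_mem_orthogonal (hW0 : W 0 = 1)
    (hWmul : ∀ x y : G, (W x).comp (W y) = (m x y : ℂ) • W (x + y))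
    (hWunitary : ∀ (x : G) (ψ φ : H), @inner ℂ H _ (W x ψ) (W x φ) = @inner ℂ H _ ψ φ)
    {S : Submodule ℂ H} (hS : ∀ x, ∀ ψ ∈ S, W x ψ ∈ S) (x : G) {φ : H} (hφ : φ ∈ Sᗮ) :
    W x φ ∈ Sᗮ := by
  rw [Submodule.mem_orthogonal]
  intro ψ hψ
  have hinv : W (-x) (W x φ) = (m (-x) x : ℂ) • φ := by
    simpa [hW0] using congrArg (fun T => T φ) (hWmul (-x) x)
  rw [← hWunitary (-x), hinv, inner_smul_right,
    Submodule.inner_right_of_mem_orthogonal (hS (-x) ψ hψ) hφ, mul_zero]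

theorem projection_mem_of_mem_smallestInvariantSubspace (hW0 : W 0 = 1)
    (hWmul : ∀ x y : G, (W x).comp (W y) = (m x y : ℂ) • W (x + y))
    {K : Submodule ℂ H} (hK : IsClosed (K : Set H)) {P : H →L[ℂ] H}
    (hP : ∀ x, ∀ ψ ∈ K, P (W x ψ) ∈ K) {ψ : H}
    (hψ : ψ ∈ smallestInvariantSubspace W (K : Set H)) : P ψ ∈ K := by
  let S : Submodule ℂ H := ⨅ x, K.comap ((P.comp (W x) : H →L[ℂ] H) : H →ₗ[ℂ] H)
  have mem_S (φ : H) : φ ∈ S ↔ ∀ x, P (W x φ) ∈ K := by simp [S]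
  have hle : smallestInvariantSubspace W (K : Set H) ≤ S := by
    refine smallestInvariantSubspace_le (fun φ hφ => (mem_S φ).2 fun x => hP x φ hφ) ?_ ?_
    · have hcoe : (S : Set H) = ⋂ x, (fun φ => P (W x φ)) ⁻¹' (K : Set H) := by
        ext φ
        simp [mem_S]
      rw [hcoe]
      exact isClosed_iInter fun x => hK.preimage (P.continuous.comp (W x).continuous)
    · intro y φ hφ
      rw [mem_S] at hφ ⊢
      intro x
      have hxy : W x (W y φ) = (m x y : ℂ) • W (x + y) φ :=
        congrArg (fun T => T φ) (hWmul x y)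
      rw [hxy, map_smul]
      exact K.smul_mem _ (hφ _)
  simpa [hW0] using (mem_S ψ).1 (hle hψ) 0

end ProjectiveRepresentation

/-- Standing hypotheses; `P` the orthogonal projection of `H` onto the vacuum
space `H^L`. (a) If `K ⊆ H^L` is a closed subspace invariant under `W((1/2)L)`, then
`P(H(K)) = K`. (b) If `K₁ ⟂ K₂` are two such subspaces, then `H(K₁) ⟂ H(K₂)`.
(c) If the orthogonal direct sum of a family of such subspaces is `H^L` and `H(H^L) = H`,
then `H` is the closure of the orthogonal direct sum of the `H(K_i)`. -/
theorem stmt_8 {G : Type*} [AddCommGroup G]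
    (m : G → G → Circle)
    (hm₁ : ∀ x y z : G, m (x + y) z = m x z * m y z)
    (hm₂ : ∀ x y z : G, m x (y + z) = m x y * m x z)
    (hmalt : ∀ x : G, m x x = 1)
    (L : AddSubgroup G)
    (hL : (L : Set G) = {x : G | ∀ a ∈ L, m x a = 1})
    {H : Type*} [NormedAddCommGroup H] [InnerProductSpace ℂ H] [CompleteSpace H]
    (W : G → H →L[ℂ] H)
    (hW0 : W 0 = 1)
    (hWmul : ∀ x y : G, (W x).comp (W y) = (m x y : ℂ) • W (x + y))
    (hWunitary : ∀ (x : G) (ψ φ : H), @inner ℂ H _ (W x ψ) (W x φ) = @inner ℂ H _ ψ φ)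
    (HL : Submodule ℂ H)
    (hHL : ∀ ψ : H, ψ ∈ HL ↔ ∀ a ∈ L, W a ψ = ψ)
    (P : H →L[ℂ] H)
    (hP : ∀ ψ : H, P ψ ∈ HL ∧ ψ - P ψ ∈ HLᗮ)
    {ι : Type*} :
    (∀ K : Submodule ℂ H, K ≤ HL → IsClosed (K : Set H) →
      (∀ x : G, x + x ∈ L → ∀ ψ ∈ K, W x ψ ∈ K) →
      P '' (smallestInvariantSubspace W (K : Set H) : Set H) = (K : Set H)) ∧
    (∀ K₁ K₂ : Submodule ℂ H, K₁ ≤ HL → K₂ ≤ HL →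
      IsClosed (K₁ : Set H) → IsClosed (K₂ : Set H) →
      (∀ x : G, x + x ∈ L → ∀ ψ ∈ K₁, W x ψ ∈ K₁) →
      (∀ x : G, x + x ∈ L → ∀ ψ ∈ K₂, W x ψ ∈ K₂) →
      (∀ ψ ∈ K₁, ∀ φ ∈ K₂, @inner ℂ H _ ψ φ = 0) →
      ∀ ψ ∈ smallestInvariantSubspace W (K₁ : Set H),
        ∀ φ ∈ smallestInvariantSubspace W (K₂ : Set H), @inner ℂ H _ ψ φ = 0) ∧
    (∀ K : ι → Submodule ℂ H,
      (∀ i, K i ≤ HL) → (∀ i, IsClosed ((K i : Set H))) →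
      (∀ i, ∀ x : G, x + x ∈ L → ∀ ψ ∈ K i, W x ψ ∈ K i) →
      (∀ i j, i ≠ j → ∀ ψ ∈ K i, ∀ φ ∈ K j, @inner ℂ H _ ψ φ = 0) →
      HL = (⨆ i, K i).topologicalClosure →
      smallestInvariantSubspace W (HL : Set H) = ⊤ →
      (⨆ i, smallestInvariantSubspace W ((K i : Set H))).topologicalClosure = ⊤) := by
  have hPid : ∀ ψ ∈ HL, P ψ = ψ := fun ψ hψ =>
    (sub_eq_zero.1 (inner_self_eq_zero.1 (Submodule.inner_right_of_mem_orthogonal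
      (HL.sub_mem hψ (hP ψ).1) (hP ψ).2))).symm
  have hPzero : ∀ ψ ∈ HLᗮ, P ψ = 0 := fun ψ hψ => by
    have h : P ψ ∈ HLᗮ := by simpa using HLᗮ.sub_mem hψ (hP ψ).2
    exact inner_self_eq_zero.1 (Submodule.inner_right_of_mem_orthogonal (hP ψ).1 h)
  have hPmem : ∀ K : Submodule ℂ H, K ≤ HL → IsClosed (K : Set H) →
      (∀ x : G, x + x ∈ L → ∀ ψ ∈ K, W x ψ ∈ K) →
      ∀ ψ ∈ smallestInvariantSubspace W (K : Set H), P ψ ∈ K := by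
    intro K hKHL hKc hKW ψ hψ
    refine projection_mem_of_mem_smallestInvariantSubspace hW0 hWmul hKc ?_ hψ
    intro x φ hφ
    by_cases hx : x + x ∈ L
    · have h := hKW x hx φ hφ
      rwa [hPid _ (hKHL h)]
    · rw [hPzero _ (map_mem_orthogonal_of_add_self_notMem hm₁ hm₂ hmalt hL hWmul hWunitary
        hHL hx (hKHL hφ))]
      exact K.zero_mem
  refine ⟨?_, ?_, ?_⟩
  · intro K hKHL hKc hKW
    refine Set.Subset.antisymm ?_ fun ψ hψ =>
      ⟨ψ, subset_smallestInvariantSubspace _ hψ, hPid ψ (hKHL hψ)⟩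
    rintro _ ⟨ψ, hψ, rfl⟩
    exact hPmem K hKHL hKc hKW ψ hψ
  · intro K₁ K₂ h₁ h₂ hc₁ _ hW₁ _ horth ψ hψ φ hφ
    have hle : smallestInvariantSubspace W (K₂ : Set H) ≤
        (smallestInvariantSubspace W (K₁ : Set H))ᗮ := by
      refine smallestInvariantSubspace_le ?_ (Submodule.isClosed_orthogonal _) fun x χ hχ =>
        map_mem_orthogonal hW0 hWmul hWunitary
          (fun y _ h => map_mem_smallestInvariantSubspace y h) x hχ
      intro k hk
      rw [SetLike.mem_coe, Submodule.mem_orthogonal]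
      intro χ hχ
      have hproj := horth _ (hPmem K₁ h₁ hc₁ hW₁ χ hχ) k hk
      have hdiff := Submodule.inner_left_of_mem_orthogonal (h₂ hk) (hP χ).2
      rwa [inner_sub_left, hproj, sub_zero] at hdiff
    exact Submodule.inner_right_of_mem_orthogonal hψ (hle hφ)
  · intro K _ _ _ _ hsum htop
    rw [eq_top_iff, ← htop]
    refine smallestInvariantSubspace_le ?_ (Submodule.isClosed_topologicalClosure _)
      fun x ψ hψ => map_mem_topologicalClosure_iSup
        (fun i _ h => map_mem_smallestInvariantSubspace x h) hψ
    rw [hsum]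
    exact Submodule.topologicalClosure_mono
      (iSup_mono fun i => subset_smallestInvariantSubspace (K i : Set H))
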